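/- Let X be a finite equilateral metric graph (all ℓ_e = 1), G ⊆ G^max a vertex space with projection P, m ∈ ℝ, and let M̃ : G ⊕ G → G ⊕ G be a self-adjoint linear operator. Let λ ∈ ℂ with λ − m² ≠ (πk)² for every integer k ≥ 1, and let θ ∈ ℂ with θ² = λ − m². Then λ is an eigenvalue of the ℂ²-valued metric graph Laplacian Δ̃^{M̃} — i.e. there exists a nonzero pair f = (f₀, f₁), each f_p = (f_{p,e}) a family of twice continuously differentiable functions on [0,1], with −f_{p,e}'' + m² f_{p,e} = λ f_{p,e} on each edge for p = 0,1, with (f̲₀, f̲₁) ∈ G ⊕ G, and with (P(f₀'̲°), P(f₁'̲°)) = M̃ (f̲₀, f̲₁) — if and only if 0 is an eigenvalue of the operator on G ⊕ G given by (F₀, F₁) ↦ ( Δ_G F₀ − (1 − cos θ)F₀ , Δ_G F₁ − (1 − cos θ)F₁ ) − sin₁(θ)·M̃(F₀, F₁). Moreover the corresponding eigenspaces have equal dimension. -/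

import Mathlib

noncomputable section

open Complex Set MeasureTheory

variable {V E : Type*}

/-- Maximal vertex space: one copy of `ℂ` for each half-edge `(e, endpoint)`;
`(e, false)` corresponds to the initial vertex `∂₋e`, `(e, true)` to the terminal
vertex `∂₊e`. -/
abbrev Gmax (E : Type*) := E × Bool → ℂ

/-- The vertex of a half-edge, given the boundary map `bd` of the graph
(`bd false = ∂₋`, `bd true = ∂₊`). -/
def hvtx (bd : Bool → E → V) (h : E × Bool) : V := bd h.2 h.1

/-- The opposite half-edge on the same edge. -/
def hopp {E : Type*} (h : E × Bool) : E × Bool := (h.1, !h.2)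

/-- The standard Hermitian inner product on `Gmax E` (conjugate-linear in the
first argument). -/
def vinner [Fintype E] (F F' : Gmax E) : ℂ :=
  ∑ h : E × Bool, (starRingEnd ℂ) (F h) * F' h

/-- The squared norm on `Gmax E`. -/
def vnormSq [Fintype E] (F : Gmax E) : ℝ := ∑ h : E × Bool, ‖F h‖ ^ 2

/-- Restriction of `F` to the components sitting at the vertex `v`. -/
def restrAt [DecidableEq V] (bd : Bool → E → V) (v : V) (F : Gmax E) : Gmax E :=
  fun h => if bd h.2 h.1 = v then F h else 0

/-- Unoriented vertex evaluation of a family of edge functions. -/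
def utrace (ℓ : E → ℝ) (f : E → ℝ → ℂ) : Gmax E :=
  fun h => if h.2 then f h.1 (ℓ h.1) else f h.1 0

/-- Oriented vertex evaluation of a family of edge functions. -/
def otrace (ℓ : E → ℝ) (f : E → ℝ → ℂ) : Gmax E :=
  fun h => if h.2 then f h.1 (ℓ h.1) else -f h.1 0

/-- The generalised discrete Laplacian `Δ_G`, written with the (local) orthogonal
projection `P` onto the vertex space. -/
def discLap (ℓ : E → ℝ) (P : Gmax E →ₗ[ℂ] Gmax E) (F : Gmax E) : Gmax E :=
  P fun h => (ℓ h.1 : ℂ)⁻¹ * (F h - F (hopp h))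

/-- Krein's Q-function, for spectral parameter `z = θ ^ 2 ≠ 0`. -/
def QRaw (ℓ : E → ℝ) (P : Gmax E →ₗ[ℂ] Gmax E) (θ : ℂ) (F : Gmax E) : Gmax E :=
  P fun h => (θ / Complex.sin (θ * (ℓ h.1 : ℂ))) *
      (Complex.cos (θ * (ℓ h.1 : ℂ)) * F h - F (hopp h))

/-- Krein's Q-function, including the value `z = 0` where `Q(0) = Δ_G`. -/
def QFull (ℓ : E → ℝ) (P : Gmax E →ₗ[ℂ] Gmax E) (z θ : ℂ) (F : Gmax E) : Gmax E :=
  if z = 0 then discLap ℓ P F else QRaw ℓ P θ F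

/-- The solution operator (Krein Γ-field) `β(z)` for `z = θ ^ 2 ≠ 0`. -/
def betaFun (ℓ : E → ℝ) (θ : ℂ) (F : Gmax E) : E → ℝ → ℂ := fun e x =>
  F (e, false) * Complex.sin (θ * ((ℓ e : ℂ) - (x : ℂ))) / Complex.sin (θ * (ℓ e : ℂ))
    + F (e, true) * Complex.sin (θ * (x : ℂ)) / Complex.sin (θ * (ℓ e : ℂ))

/-- The solution operator `β(z)`, including the value `z = 0`. -/
def betaFull (ℓ : E → ℝ) (z θ : ℂ) (F : Gmax E) : E → ℝ → ℂ :=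
  if z = 0 then
    fun e x => F (e, false) * (1 - (x : ℂ) / (ℓ e : ℂ)) + F (e, true) * ((x : ℂ) / (ℓ e : ℂ))
  else betaFun ℓ θ F

/-- `sin₁ θ = sin θ / θ` with `sin₁ 0 = 1`. -/
def sin1 (θ : ℂ) : ℂ := if θ = 0 then 1 else Complex.sin θ / θ

/-- `f` belongs to the eigenspace of the metric-graph Laplacian `Δ_{(G,L)}` for the
eigenvalue `z`: each `f_e` is twice continuously differentiable on `[0, ℓ_e]`,
`-f_e'' = z f_e` on each edge, the unoriented vertex evaluation lies in `G`, and the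
vertex condition `P f'̲° = L f̲` holds. -/
def IsLapEigenfun (ℓ : E → ℝ) (G : Submodule ℂ (Gmax E)) (P : Gmax E →ₗ[ℂ] Gmax E)
    (L : G →ₗ[ℂ] G) (z : ℂ) (f : E → ℝ → ℂ) : Prop :=
  (∀ e, ContDiffOn ℝ 2 (f e) (Icc 0 (ℓ e))) ∧
  (∀ e, ∀ x ∈ Icc (0 : ℝ) (ℓ e),
      iteratedDerivWithin 2 (f e) (Icc 0 (ℓ e)) x = -(z * f e x)) ∧
  ∃ hf : utrace ℓ f ∈ G,
    P (otrace ℓ fun e x => derivWithin (f e) (Icc 0 (ℓ e)) x)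
      = ↑(L ⟨utrace ℓ f, hf⟩)

/-- `(f₀, f₁)` belongs to the eigenspace of the `ℂ²`-valued metric-graph Laplacian
`Δ̃^{M̃}` for the eigenvalue `λ` (equilateral case): each component is edgewise `C²`,
`-f_p'' + m² f_p = λ f_p` on each edge, the vertex values lie in `G ⊕ G`, and the
vertex condition `(P f̲₀'°, P f̲₁'°) = M̃ (f̲₀, f̲₁)` holds. -/
def IsVecLapEigenfun {E : Type*} (G : Submodule ℂ (Gmax E))
    (P : Gmax E →ₗ[ℂ] Gmax E) (Mt : G × G →ₗ[ℂ] G × G) (m : ℝ) (lam : ℂ)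
    (f₀ f₁ : E → ℝ → ℂ) : Prop :=
  (∀ e, ContDiffOn ℝ 2 (f₀ e) (Icc 0 1)) ∧
  (∀ e, ContDiffOn ℝ 2 (f₁ e) (Icc 0 1)) ∧
  (∀ e, ∀ x ∈ Icc (0 : ℝ) 1,
      -iteratedDerivWithin 2 (f₀ e) (Icc 0 1) x + (m : ℂ) ^ 2 * f₀ e x = lam * f₀ e x) ∧
  (∀ e, ∀ x ∈ Icc (0 : ℝ) 1,
      -iteratedDerivWithin 2 (f₁ e) (Icc 0 1) x + (m : ℂ) ^ 2 * f₁ e x = lam * f₁ e x) ∧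
  ∃ (h₀ : utrace (fun _ => 1) f₀ ∈ G) (h₁ : utrace (fun _ => 1) f₁ ∈ G),
    P (otrace (fun _ => 1) fun e x => derivWithin (f₀ e) (Icc 0 1) x)
        = ↑((Mt (⟨utrace (fun _ => 1) f₀, h₀⟩, ⟨utrace (fun _ => 1) f₁, h₁⟩)).1) ∧
    P (otrace (fun _ => 1) fun e x => derivWithin (f₁ e) (Icc 0 1) x)
        = ↑((Mt (⟨utrace (fun _ => 1) f₀, h₀⟩, ⟨utrace (fun _ => 1) f₁, h₁⟩)).2)

/-- Kernel condition for the discrete operator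
`(F₀, F₁) ↦ (Δ_G F₀ - (1-cos θ)F₀, Δ_G F₁ - (1-cos θ)F₁) - sin₁θ·M̃(F₀,F₁)`. -/
def kerCondV {E : Type*} (G : Submodule ℂ (Gmax E)) (P : Gmax E →ₗ[ℂ] Gmax E)
    (Mt : G × G →ₗ[ℂ] G × G) (θ : ℂ) (Fp : G × G) : Prop :=
  discLap (fun _ => 1) P (↑Fp.1 : Gmax E) - (1 - Complex.cos θ) • (↑Fp.1 : Gmax E)
      - sin1 θ • (↑((Mt Fp).1) : Gmax E) = 0 ∧
  discLap (fun _ => 1) P (↑Fp.2 : Gmax E) - (1 - Complex.cos θ) • (↑Fp.2 : Gmax E)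
      - sin1 θ • (↑((Mt Fp).2) : Gmax E) = 0

/-- The solution `S` of `S'' = -θ² S` with `S 0 = 0` and `S' 0 = 1`. -/
def sinDiv (θ : ℂ) (x : ℝ) : ℂ := if θ = 0 then (x : ℂ) else Complex.sin (θ * x) / θ

lemma sinDiv_zero (θ : ℂ) : sinDiv θ 0 = 0 := by
  simp [sinDiv]

lemma sinDiv_one (θ : ℂ) : sinDiv θ 1 = sin1 θ := by
  simp [sinDiv, sin1]

lemma cos_sq_add_sq_mul_sinDiv_sq (θ : ℂ) (x : ℝ) :
    Complex.cos (θ * x) ^ 2 + θ ^ 2 * sinDiv θ x ^ 2 = 1 := by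
  by_cases h : θ = 0
  · simp [h]
  · rw [sinDiv, if_neg h, div_pow, mul_div_cancel₀ _ (pow_ne_zero 2 h), Complex.cos_sq_add_sin_sq]

lemma hasDerivAt_sinDiv (θ : ℂ) (x : ℝ) :
    HasDerivAt (sinDiv θ) (Complex.cos (θ * x)) x := by
  by_cases h : θ = 0
  · have : sinDiv θ = fun y : ℝ => (y : ℂ) := by ext; simp [sinDiv, h]
    rw [this, h, zero_mul, Complex.cos_zero]
    exact Complex.ofRealCLM.hasDerivAt
  · have : sinDiv θ = fun y : ℝ => Complex.sin (θ * y) / θ := by ext; simp [sinDiv, h]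
    rw [this]
    have h1 : HasDerivAt (fun y : ℂ => Complex.sin (θ * y) / θ)
        (Complex.cos (θ * x) * (θ * 1) / θ) (x : ℂ) :=
      (((hasDerivAt_id (x : ℂ)).const_mul θ).csin).div_const θ
    convert h1.comp_ofReal using 1
    field_simp

lemma hasDerivAt_cos_mul (θ : ℂ) (x : ℝ) :
    HasDerivAt (fun y : ℝ => Complex.cos (θ * y)) (-(θ ^ 2 * sinDiv θ x)) x := by
  have h1 : HasDerivAt (fun y : ℂ => Complex.cos (θ * y))
      (-Complex.sin (θ * x) * (θ * 1)) (x : ℂ) :=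
    ((hasDerivAt_id (x : ℂ)).const_mul θ).ccos
  convert h1.comp_ofReal using 1
  by_cases h : θ = 0
  · simp [h]
  · rw [sinDiv, if_neg h]
    field_simp

/-- The solution `u` of `u'' = -θ² u` with `u 0 = a` and `u' 0 = b`. -/
def cauchySol (θ a b : ℂ) (x : ℝ) : ℂ := a * Complex.cos (θ * x) + b * sinDiv θ x

lemma hasDerivAt_cauchySol (θ a b : ℂ) (x : ℝ) :
    HasDerivAt (cauchySol θ a b) (cauchySol θ b (-(θ ^ 2 * a)) x) x := by
  refine (((hasDerivAt_cos_mul θ x).const_mul a).add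
    ((hasDerivAt_sinDiv θ x).const_mul b)).congr_deriv ?_
  rw [cauchySol]
  ring

lemma contDiff_cauchySol (θ a b : ℂ) (n : ℕ) : ContDiff ℝ n (cauchySol θ a b) := by
  induction n generalizing a b with
  | zero =>
    exact contDiff_zero.2
      (continuous_iff_continuousAt.2 fun x => (hasDerivAt_cauchySol θ a b x).continuousAt)
  | succ n ih =>
    push_cast
    refine contDiff_succ_iff_deriv.2
      ⟨fun x => (hasDerivAt_cauchySol θ a b x).differentiableAt, by simp, ?_⟩
    rw [funext fun x => (hasDerivAt_cauchySol θ a b x).deriv]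
    exact ih _ _

lemma derivWithin_cauchySol (θ a b : ℂ) {x : ℝ} (hx : x ∈ Icc (0 : ℝ) 1) :
    derivWithin (cauchySol θ a b) (Icc 0 1) x = cauchySol θ b (-(θ ^ 2 * a)) x :=
  (hasDerivAt_cauchySol θ a b x).hasDerivWithinAt.derivWithin
    (uniqueDiffOn_Icc zero_lt_one x hx)

lemma iteratedDerivWithin_two_cauchySol (θ a b : ℂ) {x : ℝ} (hx : x ∈ Icc (0 : ℝ) 1) :
    iteratedDerivWithin 2 (cauchySol θ a b) (Icc 0 1) x = -(θ ^ 2 * cauchySol θ a b x) := by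
  have h : EqOn (iteratedDerivWithin 1 (cauchySol θ a b) (Icc 0 1))
      (cauchySol θ b (-(θ ^ 2 * a))) (Icc 0 1) := fun y hy => by
    rw [iteratedDerivWithin_one, derivWithin_cauchySol θ a b hy]
  rw [iteratedDerivWithin_succ, derivWithin_congr h (h hx), derivWithin_cauchySol _ _ _ hx]
  simp only [cauchySol]
  ring

/-- A `C²` solution of `f'' = -θ² f` on `[0, 1]` is determined by its Cauchy data at `0`. -/
lemma eqOn_cauchySol {θ : ℂ} {f : ℝ → ℂ} (hf : ContDiffOn ℝ 2 f (Icc 0 1))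
    (hode : ∀ x ∈ Icc (0 : ℝ) 1, iteratedDerivWithin 2 f (Icc 0 1) x = -(θ ^ 2 * f x)) :
    EqOn f (cauchySol θ (f 0) (derivWithin f (Icc 0 1) 0)) (Icc 0 1) := by
  have hu : UniqueDiffOn ℝ (Icc (0 : ℝ) 1) := uniqueDiffOn_Icc zero_lt_one
  set g := derivWithin f (Icc 0 1) with hg
  have hf' : ∀ x ∈ Icc (0 : ℝ) 1, HasDerivWithinAt f (g x) (Icc 0 1) x := fun x hx =>
    ((hf.differentiableOn (by norm_num)) x hx).hasDerivWithinAt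
  have hg' : ∀ x ∈ Icc (0 : ℝ) 1, HasDerivWithinAt g (-(θ ^ 2 * f x)) (Icc 0 1) x := by
    intro x hx
    have hd : DifferentiableOn ℝ g (Icc 0 1) :=
      (hf.derivWithin hu (m := 1) (by norm_num)).differentiableOn (by norm_num)
    have h2 := (hd x hx).hasDerivWithinAt
    rwa [← hode x hx, iteratedDerivWithin_succ, iteratedDerivWithin_one]
  have hconst : ∀ w : ℝ → ℂ, (∀ x ∈ Icc (0 : ℝ) 1, HasDerivWithinAt w 0 (Icc 0 1) x) →
      ∀ x ∈ Icc (0 : ℝ) 1, w x = w 0 := by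
    intro w hw
    refine constant_of_derivWithin_zero (fun x hx => (hw x hx).differentiableWithinAt) ?_
    exact fun x hx => (hw x (Ico_subset_Icc_self hx)).derivWithin
      (hu x (Ico_subset_Icc_self hx))
  have h1 := hconst (fun x => f x * Complex.cos (θ * x) - g x * sinDiv θ x) fun x hx => by
    refine (((hf' x hx).mul (hasDerivAt_cos_mul θ x).hasDerivWithinAt).sub
      ((hg' x hx).mul (hasDerivAt_sinDiv θ x).hasDerivWithinAt)).congr_deriv ?_
    ring
  have h2 := hconst (fun x => f x * (θ ^ 2 * sinDiv θ x) + g x * Complex.cos (θ * x))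
    fun x hx => by
      refine (((hf' x hx).mul ((hasDerivAt_sinDiv θ x).const_mul (θ ^ 2)).hasDerivWithinAt).add
        ((hg' x hx).mul (hasDerivAt_cos_mul θ x).hasDerivWithinAt)).congr_deriv ?_
      ring
  intro x hx
  have e1 := h1 x hx
  have e2 := h2 x hx
  simp only [sinDiv_zero, Complex.ofReal_zero, mul_zero, Complex.cos_zero, mul_one, sub_zero,
    zero_add] at e1 e2
  rw [cauchySol, ← e1, ← e2]
  linear_combination -(f x) * cos_sq_add_sq_mul_sinDiv_sq θ x

lemma sin1_ne_zero {θ : ℂ} (hθ : ∀ k : ℕ, 1 ≤ k → θ ^ 2 ≠ ((Real.pi * k : ℝ) : ℂ) ^ 2) :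
    sin1 θ ≠ 0 := by
  by_cases h : θ = 0
  · simp [sin1, h]
  rw [sin1, if_neg h]
  refine div_ne_zero (fun hs => ?_) h
  obtain ⟨k, rfl⟩ := Complex.sin_eq_zero_iff.1 hs
  refine hθ k.natAbs (Nat.one_le_iff_ne_zero.2 fun hk => h ?_) ?_
  · simp [Int.natAbs_eq_zero.1 hk]
  · have : ((k.natAbs : ℂ)) ^ 2 = (k : ℂ) ^ 2 := by
      rw [Nat.cast_natAbs, ← Int.cast_pow, sq_abs, Int.cast_pow]
    push_cast
    rw [mul_pow, mul_pow, this]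
    ring

/-- The edgewise solution of `u'' = -θ² u` with prescribed values at both ends. -/
def dirichletSol (θ : ℂ) (F : Gmax E) (e : E) : ℝ → ℂ :=
  cauchySol θ (F (e, false)) ((F (e, true) - Complex.cos θ * F (e, false)) / sin1 θ)

lemma dirichletSol_add_smul (θ : ℂ) (F F' : Gmax E) (c : ℂ) (e : E) (x : ℝ) :
    dirichletSol θ (F + c • F') e x = dirichletSol θ F e x + c * dirichletSol θ F' e x := by
  simp only [dirichletSol, cauchySol, Pi.add_apply, Pi.smul_apply, smul_eq_mul]
  ring

lemma utrace_congr {f g : E → ℝ → ℂ} (h : ∀ e, EqOn (f e) (g e) (Icc 0 1)) :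
    utrace (fun _ => 1) f = utrace (fun _ => 1) g := by
  ext ⟨e, b⟩
  cases b
  · simpa [utrace] using h e (left_mem_Icc.2 zero_le_one)
  · simpa [utrace] using h e (right_mem_Icc.2 zero_le_one)

lemma otrace_derivWithin_congr {f g : E → ℝ → ℂ} (h : ∀ e, EqOn (f e) (g e) (Icc 0 1)) :
    otrace (fun _ => 1) (fun e x => derivWithin (f e) (Icc 0 1) x)
      = otrace (fun _ => 1) (fun e x => derivWithin (g e) (Icc 0 1) x) := by
  ext ⟨e, b⟩
  cases b
  · simpa [otrace] using derivWithin_congr (h e) (h e (left_mem_Icc.2 zero_le_one))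
  · simpa [otrace] using derivWithin_congr (h e) (h e (right_mem_Icc.2 zero_le_one))

lemma utrace_dirichletSol {θ : ℂ} (hs : sin1 θ ≠ 0) (F : Gmax E) :
    utrace (fun _ => 1) (dirichletSol θ F) = F := by
  ext ⟨e, b⟩
  cases b
  · simp [utrace, dirichletSol, cauchySol, sinDiv_zero]
  · simp only [utrace, dirichletSol, cauchySol, sinDiv_one, if_true, Complex.ofReal_one, mul_one]
    field_simp
    ring

lemma eqOn_dirichletSol {θ : ℂ} (hs : sin1 θ ≠ 0) {f : E → ℝ → ℂ} {e : E}
    (hf : ContDiffOn ℝ 2 (f e) (Icc 0 1))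
    (hode : ∀ x ∈ Icc (0 : ℝ) 1,
      iteratedDerivWithin 2 (f e) (Icc 0 1) x = -(θ ^ 2 * f e x)) :
    EqOn (f e) (dirichletSol θ (utrace (fun _ => 1) f) e) (Icc 0 1) := by
  have h := eqOn_cauchySol hf hode
  have h1 := h (right_mem_Icc.2 zero_le_one)
  rw [cauchySol, sinDiv_one, Complex.ofReal_one, mul_one] at h1
  have hd : (f e 1 - Complex.cos θ * f e 0) / sin1 θ = derivWithin (f e) (Icc 0 1) 0 := by
    rw [div_eq_iff hs, h1]
    ring
  simpa [dirichletSol, utrace, hd] using h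

lemma sin1_smul_otrace_dirichletSol {θ : ℂ} (hs : sin1 θ ≠ 0) (F : Gmax E) :
    sin1 θ • otrace (fun _ => 1) (fun e x => derivWithin (dirichletSol θ F e) (Icc 0 1) x)
      = (fun h => F h - F (hopp h)) - (1 - Complex.cos θ) • F := by
  ext ⟨e, b⟩
  cases b
  · simp only [otrace, dirichletSol, hopp, Pi.smul_apply, Pi.sub_apply, smul_eq_mul,
      derivWithin_cauchySol _ _ _ (left_mem_Icc.2 (zero_le_one (α := ℝ)))]
    simp [cauchySol, sinDiv_zero]
    field_simp
    ring
  · simp only [otrace, dirichletSol, hopp, Pi.smul_apply, Pi.sub_apply, smul_eq_mul,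
      derivWithin_cauchySol _ _ _ (right_mem_Icc.2 (zero_le_one (α := ℝ)))]
    have hcs := cos_sq_add_sq_mul_sinDiv_sq θ 1
    simp only [sinDiv_one, Complex.ofReal_one, mul_one] at hcs
    simp [cauchySol, sinDiv_one]
    field_simp
    linear_combination -F (e, false) * hcs

lemma vertexCondition_dirichletSol_iff {P : Gmax E →ₗ[ℂ] Gmax E} {θ : ℂ} (hs : sin1 θ ≠ 0)
    {F : Gmax E} (hF : P F = F) (L : Gmax E) :
    P (otrace (fun _ => 1) fun e x => derivWithin (dirichletSol θ F e) (Icc 0 1) x) = L ↔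
      discLap (fun _ => 1) P F - (1 - Complex.cos θ) • F - sin1 θ • L = 0 := by
  have hd : discLap (fun _ => 1) P F = P fun h => F h - F (hopp h) := by simp [discLap]
  have hQ := congrArg P (sin1_smul_otrace_dirichletSol hs F)
  rw [map_smul, map_sub, map_smul, hF, ← hd] at hQ
  rw [sub_eq_zero, ← hQ]
  exact (smul_right_injective _ hs).eq_iff.symm

lemma isVecLapEigenfun_dirichletSol_iff {G : Submodule ℂ (Gmax E)}
    {P : Gmax E →ₗ[ℂ] Gmax E} (hPfix : ∀ F ∈ G, P F = F) (Mt : G × G →ₗ[ℂ] G × G) {m : ℝ}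
    {lam θ : ℂ} (hθ : θ ^ 2 = lam - (m : ℂ) ^ 2) (hs : sin1 θ ≠ 0) (Fp : G × G) :
    IsVecLapEigenfun G P Mt m lam (dirichletSol θ Fp.1) (dirichletSol θ Fp.2) ↔
      kerCondV G P Mt θ Fp := by
  have hode : ∀ (F : Gmax E) (e : E), ∀ x ∈ Icc (0 : ℝ) 1,
      -iteratedDerivWithin 2 (dirichletSol θ F e) (Icc 0 1) x
        + (m : ℂ) ^ 2 * dirichletSol θ F e x = lam * dirichletSol θ F e x := by
    intro F e x hx
    rw [dirichletSol, iteratedDerivWithin_two_cauchySol _ _ _ hx]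
    linear_combination (cauchySol θ _ _ x) * hθ
  have hsmooth : ∀ (F : Gmax E) (e : E), ContDiffOn ℝ 2 (dirichletSol θ F e) (Icc 0 1) :=
    fun F e => (contDiff_cauchySol θ _ _ 2).contDiffOn
  simp only [IsVecLapEigenfun, kerCondV, utrace_dirichletSol hs, hsmooth, implies_true, true_and,
    vertexCondition_dirichletSol_iff hs (hPfix _ Fp.1.2),
    vertexCondition_dirichletSol_iff hs (hPfix _ Fp.2.2), Subtype.coe_eta, Prod.mk.eta,
    SetLike.coe_mem, exists_true_left]
  exact ⟨fun h => h.2.2, fun h => ⟨hode _, hode _, h⟩⟩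

lemma IsVecLapEigenfun.exists_kerCondV {G : Submodule ℂ (Gmax E)}
    {P : Gmax E →ₗ[ℂ] Gmax E} (hPfix : ∀ F ∈ G, P F = F) {Mt : G × G →ₗ[ℂ] G × G} {m : ℝ}
    {lam θ : ℂ} (hθ : θ ^ 2 = lam - (m : ℂ) ^ 2) (hs : sin1 θ ≠ 0) {f₀ f₁ : E → ℝ → ℂ}
    (hf : IsVecLapEigenfun G P Mt m lam f₀ f₁) :
    ∃ Fp : G × G, kerCondV G P Mt θ Fp ∧
      (∀ e, EqOn (f₀ e) (dirichletSol θ Fp.1 e) (Icc 0 1)) ∧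
      (∀ e, EqOn (f₁ e) (dirichletSol θ Fp.2 e) (Icc 0 1)) := by
  obtain ⟨c₀, c₁, ode₀, ode₁, h₀, h₁, v₀, v₁⟩ := hf
  have e₀ : ∀ e, EqOn (f₀ e) (dirichletSol θ (utrace (fun _ => 1) f₀) e) (Icc 0 1) := fun e =>
    eqOn_dirichletSol hs (c₀ e) fun x hx => by
      linear_combination -(ode₀ e x hx) + f₀ e x * hθ
  have e₁ : ∀ e, EqOn (f₁ e) (dirichletSol θ (utrace (fun _ => 1) f₁) e) (Icc 0 1) := fun e =>
    eqOn_dirichletSol hs (c₁ e) fun x hx => by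
      linear_combination -(ode₁ e x hx) + f₁ e x * hθ
  refine ⟨(⟨_, h₀⟩, ⟨_, h₁⟩), ⟨?_, ?_⟩, e₀, e₁⟩
  · rw [← vertexCondition_dirichletSol_iff hs (hPfix _ h₀), ← otrace_derivWithin_congr e₀, v₀]
  · rw [← vertexCondition_dirichletSol_iff hs (hPfix _ h₁), ← otrace_derivWithin_congr e₁, v₁]

lemma eq_of_eqOn_dirichletSol {θ : ℂ} (hs : sin1 θ ≠ 0) {F F' : Gmax E}
    (h : ∀ e, EqOn (dirichletSol θ F e) (dirichletSol θ F' e) (Icc 0 1)) : F = F' := by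
  rw [← utrace_dirichletSol hs F, utrace_congr h, utrace_dirichletSol hs]

lemma dirichletSol_zero (θ : ℂ) (e : E) (x : ℝ) : dirichletSol θ (0 : Gmax E) e x = 0 := by
  simp [dirichletSol, cauchySol]

/-- On a finite equilateral metric graph, for a self-adjoint
`M̃ : G ⊕ G → G ⊕ G` and `λ` with `λ - m² = θ²` off the Dirichlet spectrum, `λ` is an
eigenvalue of the `ℂ²`-valued Laplacian `Δ̃^{M̃}` iff `0` is an eigenvalue of the
discrete operator `(F₀,F₁) ↦ (Δ_G F₀ - (1-cosθ)F₀, Δ_G F₁ - (1-cosθ)F₁) - sin₁θ·M̃(F₀,F₁)`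
on `G ⊕ G`; moreover the eigenspaces have equal dimension. -/
theorem statement4 [Fintype V] [Fintype E] [DecidableEq V]
    (bd : Bool → E → V)
    (G : Submodule ℂ (Gmax E)) (P : Gmax E →ₗ[ℂ] Gmax E)
    (hPmem : ∀ F, P F ∈ G) (hPfix : ∀ F ∈ G, P F = F)
    (hPsa : ∀ F F' : Gmax E, vinner (P F) F' = vinner F (P F'))
    (hPloc : ∀ (F : Gmax E) (v : V), P (restrAt bd v F) = restrAt bd v (P F))
    (m : ℝ) (Mt : G × G →ₗ[ℂ] G × G)
    (hMt : ∀ x y : G × G,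
      vinner (↑(Mt x).1 : Gmax E) (↑y.1 : Gmax E)
          + vinner (↑(Mt x).2 : Gmax E) (↑y.2 : Gmax E)
        = vinner (↑x.1 : Gmax E) (↑(Mt y).1 : Gmax E)
          + vinner (↑x.2 : Gmax E) (↑(Mt y).2 : Gmax E))
    (lam θ : ℂ) (hθ : θ ^ 2 = lam - (m : ℂ) ^ 2)
    (hlam : ∀ k : ℕ, 1 ≤ k → lam - (m : ℂ) ^ 2 ≠ ((Real.pi * k : ℝ) : ℂ) ^ 2) :
    -- the spectral relation for eigenvalues
    ((∃ f₀ f₁ : E → ℝ → ℂ,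
        IsVecLapEigenfun G P Mt m lam f₀ f₁ ∧
          ∃ e, ∃ x ∈ Icc (0 : ℝ) 1, f₀ e x ≠ 0 ∨ f₁ e x ≠ 0) ↔
      ∃ Fp : G × G, Fp ≠ 0 ∧ kerCondV G P Mt θ Fp) ∧
    -- the eigenspaces have equal dimension: a linear bijection
    (∃ Φ₀ Φ₁ : Gmax E × Gmax E → E → ℝ → ℂ,
      (∀ (Fp Fp' : Gmax E × Gmax E) (c : ℂ) (e : E) (x : ℝ),
          Φ₀ (Fp + c • Fp') e x = Φ₀ Fp e x + c * Φ₀ Fp' e x) ∧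
      (∀ (Fp Fp' : Gmax E × Gmax E) (c : ℂ) (e : E) (x : ℝ),
          Φ₁ (Fp + c • Fp') e x = Φ₁ Fp e x + c * Φ₁ Fp' e x) ∧
      (∀ Fp : G × G, kerCondV G P Mt θ Fp →
          IsVecLapEigenfun G P Mt m lam (Φ₀ (↑Fp.1, ↑Fp.2)) (Φ₁ (↑Fp.1, ↑Fp.2))) ∧
      (∀ Fp Fp' : G × G, kerCondV G P Mt θ Fp → kerCondV G P Mt θ Fp' →
          (∀ e, EqOn (Φ₀ (↑Fp.1, ↑Fp.2) e) (Φ₀ (↑Fp'.1, ↑Fp'.2) e) (Icc 0 1)) →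
          (∀ e, EqOn (Φ₁ (↑Fp.1, ↑Fp.2) e) (Φ₁ (↑Fp'.1, ↑Fp'.2) e) (Icc 0 1)) →
          Fp = Fp') ∧
      (∀ f₀ f₁ : E → ℝ → ℂ, IsVecLapEigenfun G P Mt m lam f₀ f₁ →
          ∃ Fp : G × G, kerCondV G P Mt θ Fp ∧
            (∀ e, EqOn (f₀ e) (Φ₀ (↑Fp.1, ↑Fp.2) e) (Icc 0 1)) ∧
            (∀ e, EqOn (f₁ e) (Φ₁ (↑Fp.1, ↑Fp.2) e) (Icc 0 1)))) := by
  have hs : sin1 θ ≠ 0 := sin1_ne_zero (by rwa [hθ])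
  refine ⟨⟨?_, ?_⟩, fun Fp => dirichletSol θ Fp.1, fun Fp => dirichletSol θ Fp.2, ?_, ?_, ?_,
    ?_, ?_⟩
  · rintro ⟨f₀, f₁, hf, e, x, hx, hne⟩
    obtain ⟨Fp, hker, e₀, e₁⟩ := hf.exists_kerCondV hPfix hθ hs
    refine ⟨Fp, ?_, hker⟩
    rintro rfl
    simp [e₀ e hx, e₁ e hx, dirichletSol_zero] at hne
  · rintro ⟨Fp, hne, hker⟩
    refine ⟨_, _, (isVecLapEigenfun_dirichletSol_iff hPfix Mt hθ hs Fp).2 hker, ?_⟩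
    by_contra! h
    refine hne (Prod.ext (Subtype.ext ?_) (Subtype.ext ?_)) <;>
      refine eq_of_eqOn_dirichletSol hs fun e x hx => ?_
    · simpa [dirichletSol_zero] using (h e x hx).1
    · simpa [dirichletSol_zero] using (h e x hx).2
  · exact fun Fp Fp' c e x => dirichletSol_add_smul θ Fp.1 Fp'.1 c e x
  · exact fun Fp Fp' c e x => dirichletSol_add_smul θ Fp.2 Fp'.2 c e x
  · exact fun Fp => (isVecLapEigenfun_dirichletSol_iff hPfix Mt hθ hs Fp).2
  · exact fun Fp Fp' _ _ h₀ h₁ => Prod.ext (Subtype.ext (eq_of_eqOn_dirichletSol hs h₀))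
      (Subtype.ext (eq_of_eqOn_dirichletSol hs h₁))
  · exact fun f₀ f₁ hf => hf.exists_kerCondV hPfix hθ hs
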